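/- Convex reformulation of the primal worst problem: under assumptions (RF) and (C), (i) the infimum of (P-W) is smaller than or equal to the infimum of (P-W'); (ii) if the uncertainty set Z admits a Slater point, then the infima of (P-W) and (P-W') coincide and (P-W) is solvable if and only if (P-W') is solvable; (iii) if Z is compact and (P-W) admits a strict Slater point, then the infima of (P-W) and (P-W') coincide and (P-W) is solvable whenever (P-W') is solvable. -/

import Mathlib

noncomputable section
open scoped BigOperators Classical

/-- Dot product on `ℝ^n`. -/
def dotp {n : ℕ} (x y : Fin n → ℝ) : ℝ := ∑ i, x i * y i

/-- The (effective) domain of an extended-real-valued function. -/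
def edom {n : ℕ} (f : (Fin n → ℝ) → EReal) : Set (Fin n → ℝ) := {x | f x < ⊤}

/-- `f` is proper: it never takes the value `−∞` and is `< +∞` somewhere. -/
def ProperFn {n : ℕ} (f : (Fin n → ℝ) → EReal) : Prop := (∀ x, f x ≠ ⊥) ∧ (∃ x, f x ≠ ⊤)

/-- `f` is closed: lower semicontinuous, and either nowhere `−∞` or identically `−∞`. -/
def ClosedFn {n : ℕ} (f : (Fin n → ℝ) → EReal) : Prop :=
  LowerSemicontinuous f ∧ ((∀ x, f x ≠ ⊥) ∨ (∀ x, f x = ⊥))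

/-- Convexity of an extended-real-valued function, via convexity of its epigraph. -/
def ConvexFn {n : ℕ} (f : (Fin n → ℝ) → EReal) : Prop :=
  Convex ℝ {p : (Fin n → ℝ) × ℝ | f p.1 ≤ (p.2 : EReal)}

/-- The conjugate `f*(w) = sup_x { wᵀx − f(x) }`. -/
def conjFn {n : ℕ} (f : (Fin n → ℝ) → EReal) (w : Fin n → ℝ) : EReal :=
  ⨆ x : Fin n → ℝ, (((dotp w x : ℝ) : EReal) - f x)

/-- The support function `δ*_X(w) = sup_{x ∈ X} xᵀw`. -/
def suppFn {n : ℕ} (X : Set (Fin n → ℝ)) (w : Fin n → ℝ) : EReal :=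
  ⨆ x ∈ X, ((dotp x w : ℝ) : EReal)

/-- The convex perspective `t f(x/t)` of a proper closed convex function `f`,
equal to `t f(x/t)` for `t > 0` and to `δ*_{dom f*}(x)` for `t = 0`. -/
def persp {n : ℕ} (f : (Fin n → ℝ) → EReal) (x : Fin n → ℝ) (t : ℝ) : EReal :=
  if 0 < t then (t : EReal) * f (t⁻¹ • x) else suppFn (edom (conjFn f)) x

/-- `f` is an affine ("linear") constraint function. -/
def IsAffineFn {n : ℕ} (f : (Fin n → ℝ) → EReal) : Prop :=
  ∃ (a : Fin n → ℝ) (b : ℝ), ∀ x, f x = ((dotp a x + b : ℝ) : EReal)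

variable {dx dz I L : ℕ}

/-- Assumption (RF): each (real-valued) `f_i(x,z)` is proper, closed and convex in `x`
for every fixed `z`, and `−f_i(x,z)` is proper, closed and convex in `z` for every
fixed `x` (for real-valued functions properness is automatic and closedness amounts to
semicontinuity). -/
def AssumptionRF (f : Fin (I + 1) → (Fin dx → ℝ) → (Fin dz → ℝ) → ℝ) : Prop :=
  ∀ i,
    (∀ z, ConvexOn ℝ Set.univ (fun x => f i x z) ∧
          LowerSemicontinuous (fun x => f i x z)) ∧
    (∀ x, ConcaveOn ℝ Set.univ (fun z => f i x z) ∧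
          UpperSemicontinuous (fun z => f i x z))

/-- Assumption (C): each `c_ℓ` is proper, closed and convex. -/
def AssumptionC (c : Fin L → (Fin dz → ℝ) → EReal) : Prop :=
  ∀ ℓ, ProperFn (c ℓ) ∧ ClosedFn (c ℓ) ∧ ConvexFn (c ℓ)

/-- The uncertainty set `Z = {z : c_ℓ(z) ≤ 0 ∀ℓ}`. -/
def Zset (c : Fin L → (Fin dz → ℝ) → EReal) : Set (Fin dz → ℝ) :=
  {z | ∀ ℓ, c ℓ z ≤ 0}

/-- Partial conjugate with respect to the first argument:
`f^{*1}(w,z) = sup_x { wᵀx − f(x,z) }`. -/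
def pconj1 (f : (Fin dx → ℝ) → (Fin dz → ℝ) → ℝ)
    (w : Fin dx → ℝ) (z : Fin dz → ℝ) : EReal :=
  ⨆ x : Fin dx → ℝ, ((dotp w x - f x z : ℝ) : EReal)

/-- Convex partial perspective in the first argument of `F(w,z)`:
`t F(w/t, z)` for `t > 0` and `δ*_{dom F(·,z)}(w)` for `t = 0`. -/
def ppersp1 (F : (Fin dx → ℝ) → (Fin dz → ℝ) → EReal)
    (w : Fin dx → ℝ) (t : ℝ) (z : Fin dz → ℝ) : EReal :=
  if 0 < t then (t : EReal) * F (t⁻¹ • w) z else suppFn {w' | F w' z < ⊤} w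

/-- Worst-case function `G_i(x) = sup_{z ∈ Z} f_i(x,z)`. -/
def Gsup (f : Fin (I + 1) → (Fin dx → ℝ) → (Fin dz → ℝ) → ℝ)
    (c : Fin L → (Fin dz → ℝ) → EReal) (i : Fin (I + 1)) (x : Fin dx → ℝ) : EReal :=
  ⨆ z ∈ Zset c, ((f i x z : ℝ) : EReal)

/-- Feasible region of the primal worst problem (P-W). -/
def pwFeas (f : Fin (I + 1) → (Fin dx → ℝ) → (Fin dz → ℝ) → ℝ)
    (c : Fin L → (Fin dz → ℝ) → EReal) : Set (Fin dx → ℝ) :=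
  {x | (∀ i : Fin I, Gsup f c i.succ x ≤ 0) ∧ Gsup f c 0 x ≠ ⊤}

/-- Optimal value of the primal worst problem (P-W). -/
def pwVal (f : Fin (I + 1) → (Fin dx → ℝ) → (Fin dz → ℝ) → ℝ)
    (c : Fin L → (Fin dz → ℝ) → EReal) : EReal :=
  ⨅ x ∈ pwFeas f c, Gsup f c 0 x

/-- (P-W) is solvable. -/
def pwSolvable (f : Fin (I + 1) → (Fin dx → ℝ) → (Fin dz → ℝ) → ℝ)
    (c : Fin L → (Fin dz → ℝ) → EReal) : Prop :=
  pwFeas f c = ∅ ∨ ∃ x ∈ pwFeas f c, Gsup f c 0 x = pwVal f c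

/-- Objective of the dual best problem (D-B):
`−f₀^{*1}(w₀,z₀) − Σ_i λ_i f_i^{*1}(w_i/λ_i, z_i)`. -/
def dbObj (f : Fin (I + 1) → (Fin dx → ℝ) → (Fin dz → ℝ) → ℝ)
    (p : (Fin (I + 1) → Fin dx → ℝ) × (Fin (I + 1) → Fin dz → ℝ) × (Fin I → ℝ)) :
    EReal :=
  - pconj1 (f 0) (p.1 0) (p.2.1 0)
    - ∑ i : Fin I, ppersp1 (pconj1 (f i.succ)) (p.1 i.succ) (p.2.2 i) (p.2.1 i.succ)

/-- Feasible region of the dual best problem (D-B). -/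
def dbFeas (f : Fin (I + 1) → (Fin dx → ℝ) → (Fin dz → ℝ) → ℝ)
    (c : Fin L → (Fin dz → ℝ) → EReal) :
    Set ((Fin (I + 1) → Fin dx → ℝ) × (Fin (I + 1) → Fin dz → ℝ) × (Fin I → ℝ)) :=
  {p | (∑ j, p.1 j) = 0 ∧ (∀ j, p.2.1 j ∈ Zset c) ∧ (∀ i, 0 ≤ p.2.2 i) ∧
       dbObj f p ≠ ⊥}

/-- Optimal value of the dual best problem (D-B). -/
def dbVal (f : Fin (I + 1) → (Fin dx → ℝ) → (Fin dz → ℝ) → ℝ)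
    (c : Fin L → (Fin dz → ℝ) → EReal) : EReal :=
  ⨆ p ∈ dbFeas f c, dbObj f p

/-- (D-B) is solvable. -/
def dbSolvable (f : Fin (I + 1) → (Fin dx → ℝ) → (Fin dz → ℝ) → ℝ)
    (c : Fin L → (Fin dz → ℝ) → EReal) : Prop :=
  dbFeas f c = ∅ ∨ ∃ p ∈ dbFeas f c, dbObj f p = dbVal f c

/-- Partial conjugate of `−f` with respect to the second argument:
`(−f)^{*2}(x,y) = sup_z { yᵀz + f(x,z) }`. -/
def pconj2neg {dx dz : ℕ} (f : (Fin dx → ℝ) → (Fin dz → ℝ) → ℝ)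
    (x : Fin dx → ℝ) (y : Fin dz → ℝ) : EReal :=
  ⨆ z : Fin dz → ℝ, ((dotp y z + f x z : ℝ) : EReal)

/-- The expression
`(−f_i)^{*2}(x, y_{i0}) + Σ_ℓ ν_{iℓ} c_ℓ*(y_{iℓ}/ν_{iℓ})`
appearing in the objective and constraints of (P-W'). -/
def pwpTerm {dx dz L : ℕ} (g : (Fin dx → ℝ) → (Fin dz → ℝ) → ℝ)
    (c : Fin L → (Fin dz → ℝ) → EReal) (x : Fin dx → ℝ)
    (y : Fin (L + 1) → Fin dz → ℝ) (ν : Fin L → ℝ) : EReal :=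
  pconj2neg g x (y 0) + ∑ ℓ : Fin L, persp (conjFn (c ℓ)) (y ℓ.succ) (ν ℓ)

/-- Feasible region of the reformulated primal worst problem (P-W'). -/
def pwpFeas {dx dz I L : ℕ} (f : Fin (I + 1) → (Fin dx → ℝ) → (Fin dz → ℝ) → ℝ)
    (c : Fin L → (Fin dz → ℝ) → EReal) :
    Set ((Fin dx → ℝ) × (Fin (I + 1) → Fin (L + 1) → Fin dz → ℝ) ×
         (Fin (I + 1) → Fin L → ℝ)) :=
  {p | (∀ i : Fin I, pwpTerm (f i.succ) c p.1 (p.2.1 i.succ) (p.2.2 i.succ) ≤ 0) ∧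
       (∀ j : Fin (I + 1), (∑ ℓ, p.2.1 j ℓ) = 0) ∧
       (∀ j ℓ, 0 ≤ p.2.2 j ℓ) ∧
       pwpTerm (f 0) c p.1 (p.2.1 0) (p.2.2 0) ≠ ⊤}

/-- Optimal value of the reformulated primal worst problem (P-W'). -/
def pwpVal {dx dz I L : ℕ} (f : Fin (I + 1) → (Fin dx → ℝ) → (Fin dz → ℝ) → ℝ)
    (c : Fin L → (Fin dz → ℝ) → EReal) : EReal :=
  ⨅ p ∈ pwpFeas f c, pwpTerm (f 0) c p.1 (p.2.1 0) (p.2.2 0)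

/-- (P-W') is solvable. -/
def pwpSolvable {dx dz I L : ℕ} (f : Fin (I + 1) → (Fin dx → ℝ) → (Fin dz → ℝ) → ℝ)
    (c : Fin L → (Fin dz → ℝ) → EReal) : Prop :=
  pwpFeas f c = ∅ ∨
    ∃ p ∈ pwpFeas f c, pwpTerm (f 0) c p.1 (p.2.1 0) (p.2.2 0) = pwpVal f c

/-- Slater point of the uncertainty set `Z` (with respect to its representation via the
constraint functions `c_ℓ`). -/
def SlaterZ {dz L : ℕ} (c : Fin L → (Fin dz → ℝ) → EReal) (zS : Fin dz → ℝ) : Prop :=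
  (∀ ℓ, zS ∈ intrinsicInterior ℝ (edom (c ℓ))) ∧ zS ∈ Zset c ∧
  (∀ ℓ, ¬ IsAffineFn (c ℓ) → c ℓ zS < 0)

/-- Strict Slater point of the primal worst problem (P-W): a point in the relative
interiors of the domains of the worst-case objective and constraint functions that
satisfies every inequality constraint strictly. -/
def StrictSlaterPW {dx dz I L : ℕ}
    (f : Fin (I + 1) → (Fin dx → ℝ) → (Fin dz → ℝ) → ℝ)
    (c : Fin L → (Fin dz → ℝ) → EReal) (xS : Fin dx → ℝ) : Prop :=
  (∀ i : Fin (I + 1), xS ∈ intrinsicInterior ℝ {x | Gsup f c i x < ⊤}) ∧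
  (∀ i : Fin I, Gsup f c i.succ xS < 0)

/-- `x` is an algebraic relative interior point of `D`: every segment from a point of `D` to `x`
can be prolonged beyond `x` inside `D`. -/
def IsCorePoint {E : Type*} [AddCommGroup E] [Module ℝ E] (D : Set E) (x : E) : Prop :=
  x ∈ D ∧ ∀ z ∈ D, ∃ w ∈ D, x ∈ openSegment ℝ w z

/-- Functions that respect affine combinations of two points. -/
def IsAff {E : Type*} [AddCommGroup E] [Module ℝ E] (h : E → ℝ) : Prop :=
  ∀ (x y : E) (a b : ℝ), a + b = 1 → h (a • x + b • y) = a * h x + b * h y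

section Multipliers

variable {E ι : Type*} [AddCommGroup E] [Module ℝ E] {D : Set E} {F : E → ℝ} {x₀ : E} {M : ℝ}

theorem IsAff.convexOn {h : E → ℝ} (hh : IsAff h) (hD : Convex ℝ D) : ConvexOn ℝ D h :=
  ⟨hD, fun x _ y _ a b _ _ hab => by simp only [smul_eq_mul]; exact (hh x y a b hab).le⟩

theorem ConcaveOn.sub_mul_isAff {h : E → ℝ} (hF : ConcaveOn ℝ D F) (hh : IsAff h) (μ : ℝ) :
    ConcaveOn ℝ D (fun z => F z - μ * h z) := by
  refine ⟨hF.1, fun x hx y hy a b ha hb hab => ?_⟩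
  have h1 := hF.2 hx hy ha hb hab
  simp only [smul_eq_mul] at h1 ⊢
  rw [hh x y a b hab]
  linarith

theorem ConcaveOn.sub_mul_convexOn {h : E → ℝ} (hF : ConcaveOn ℝ D F) (hh : ConvexOn ℝ D h)
    {μ : ℝ} (hμ : 0 ≤ μ) : ConcaveOn ℝ D (fun z => F z - μ * h z) := by
  refine ⟨hF.1, fun x hx y hy a b ha hb hab => ?_⟩
  have h1 := hF.2 hx hy ha hb hab
  have h2 := mul_le_mul_of_nonneg_left (hh.2 hx hy ha hb hab) hμ
  simp only [smul_eq_mul] at h1 h2 ⊢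
  linarith

theorem ConcaveOn.sub_sum_mul_convexOn {h : ι → E → ℝ} {μ : ι → ℝ} (J : Finset ι)
    (hF : ConcaveOn ℝ D F) (hh : ∀ i ∈ J, ConvexOn ℝ D (h i)) (hμ : ∀ i ∈ J, 0 ≤ μ i) :
    ConcaveOn ℝ D (fun z => F z - ∑ i ∈ J, μ i * h i z) := by
  induction J using Finset.induction_on generalizing F with
  | empty => simpa using hF
  | insert a J ha ih =>
    have := ih (F := fun z => F z - μ a * h a z)
      (hF.sub_mul_convexOn (hh a (by simp)) (hμ a (by simp)))
      (fun i hi => hh i (by simp [hi])) (fun i hi => hμ i (by simp [hi]))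
    refine this.congr fun z _ => ?_
    simp only [Finset.sum_insert ha]
    ring

/-- The slope inequality across the level set `h ≤ 0`. -/
theorem cross_slope_le {h : E → ℝ} (hF : ConcaveOn ℝ D F) {z w : E} (hz : z ∈ D) (hw : w ∈ D)
    (hz0 : 0 < h z) (hw0 : h w < 0)
    (hM : F ((-h w / (h z - h w)) • z + (h z / (h z - h w)) • w) ≤ M) :
    (F z - M) / h z ≤ (M - F w) / (-h w) := by
  have hd : 0 < h z - h w := by linarith
  have ha : 0 ≤ -h w / (h z - h w) := div_nonneg (by linarith) hd.le
  have hb : 0 ≤ h z / (h z - h w) := div_nonneg hz0.le hd.le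
  have h1 := hF.2 hz hw ha hb (by field_simp; ring)
  have h2 := h1.trans hM
  simp only [smul_eq_mul] at h2
  have h3 : (-h w * F z + h z * F w) / (h z - h w) ≤ M := by
    refine le_of_eq_of_le ?_ h2
    field_simp
  rw [div_le_iff₀ hd] at h3
  rw [div_le_div_iff₀ hz0 (by linarith)]
  linarith

theorem exists_multiplier_of_neg {h : E → ℝ} (hF : ConcaveOn ℝ D F) (hh : ConvexOn ℝ D h)
    (hx₀ : x₀ ∈ D) (hneg : h x₀ < 0) (hM : ∀ z ∈ D, h z ≤ 0 → F z ≤ M) :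
    ∃ μ : ℝ, 0 ≤ μ ∧ ∀ z ∈ D, F z - μ * h z ≤ M := by
  set A : Set ℝ := insert 0 ((fun z => (F z - M) / h z) '' {z | z ∈ D ∧ 0 < h z}) with hA
  have key : ∀ w ∈ D, h w < 0 → ∀ a ∈ A, a ≤ (M - F w) / (-h w) := by
    rintro w hw hw0 a (rfl | ⟨z, ⟨hz, hz0⟩, rfl⟩)
    · exact div_nonneg (by linarith [hM w hw hw0.le]) (by linarith)
    · have hd : 0 < h z - h w := by linarith
      have ha : 0 ≤ -h w / (h z - h w) := div_nonneg (by linarith) hd.le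
      have hb : 0 ≤ h z / (h z - h w) := div_nonneg hz0.le hd.le
      have hab : -h w / (h z - h w) + h z / (h z - h w) = 1 := by field_simp; ring
      refine cross_slope_le hF hz hw hz0 hw0 (hM _ (hF.1 hz hw ha hb hab) ?_)
      refine (hh.2 hz hw ha hb hab).trans (le_of_eq ?_)
      simp only [smul_eq_mul]
      field_simp
      ring
  have hbdd : BddAbove A := ⟨_, fun a ha => key x₀ hx₀ hneg a ha⟩
  refine ⟨sSup A, le_csSup hbdd (Set.mem_insert _ _), fun z hz => ?_⟩
  rcases lt_trichotomy (h z) 0 with h0 | h0 | h0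
  · have : sSup A ≤ (M - F z) / (-h z) := csSup_le ⟨0, Set.mem_insert _ _⟩ (key z hz h0)
    rw [le_div_iff₀ (by linarith)] at this
    linarith
  · rw [h0]; linarith [hM z hz h0.le]
  · have : (F z - M) / h z ≤ sSup A :=
      le_csSup hbdd (Set.mem_insert_of_mem _ ⟨z, ⟨hz, h0⟩, rfl⟩)
    rw [div_le_iff₀ h0] at this
    linarith

theorem IsCorePoint.exists_pos_neg {h : E → ℝ} (hcore : IsCorePoint D x₀) (hh : IsAff h)
    (h0 : h x₀ = 0) {z : E} (hz : z ∈ D) (hne : h z ≠ 0) :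
    (∃ p ∈ D, 0 < h p) ∧ ∃ q ∈ D, h q < 0 := by
  obtain ⟨w, hw, a, b, ha, hb, hab, hx⟩ := hcore.2 z hz
  have h1 := hh w z a b hab
  rw [hx, h0] at h1
  rcases lt_or_gt_of_ne hne with hlt | hgt
  · refine ⟨⟨w, hw, ?_⟩, z, hz, hlt⟩
    by_contra hcon
    nlinarith
  · refine ⟨⟨z, hz, hgt⟩, w, hw, ?_⟩
    by_contra hcon
    nlinarith

theorem exists_multiplier_of_eq {h : E → ℝ} (hF : ConcaveOn ℝ D F) (hh : IsAff h)
    (hcore : IsCorePoint D x₀) (h0 : h x₀ = 0) (hM : ∀ z ∈ D, h z = 0 → F z ≤ M) :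
    ∃ μ : ℝ, ∀ z ∈ D, F z - μ * h z ≤ M := by
  by_cases hall : ∀ z ∈ D, h z = 0
  · exact ⟨0, fun z hz => by simpa using hM z hz (hall z hz)⟩
  push Not at hall
  obtain ⟨z₁, hz₁, hne⟩ := hall
  obtain ⟨⟨p, hp, hp0⟩, q, hq, hq0⟩ := hcore.exists_pos_neg hh h0 hz₁ hne
  set A : Set ℝ := (fun z => (F z - M) / h z) '' {z | z ∈ D ∧ 0 < h z} with hA
  have key : ∀ w ∈ D, h w < 0 → ∀ a ∈ A, a ≤ (M - F w) / (-h w) := by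
    rintro w hw hw0 a ⟨z, ⟨hz, hz0⟩, rfl⟩
    have hd : 0 < h z - h w := by linarith
    have ha : 0 ≤ -h w / (h z - h w) := div_nonneg (by linarith) hd.le
    have hb : 0 ≤ h z / (h z - h w) := div_nonneg hz0.le hd.le
    have hab : -h w / (h z - h w) + h z / (h z - h w) = 1 := by field_simp; ring
    refine cross_slope_le hF hz hw hz0 hw0 (hM _ (hF.1 hz hw ha hb hab) ?_)
    rw [hh _ _ _ _ hab]
    field_simp
    ring
  have hbdd : BddAbove A := ⟨_, fun a ha => key q hq hq0 a ha⟩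
  refine ⟨sSup A, fun z hz => ?_⟩
  rcases lt_trichotomy (h z) 0 with h0 | h0 | h0
  · have : sSup A ≤ (M - F z) / (-h z) := csSup_le ⟨_, ⟨p, ⟨hp, hp0⟩, rfl⟩⟩ (key z hz h0)
    rw [le_div_iff₀ (by linarith)] at this
    linarith
  · rw [h0]; linarith [hM z hz h0]
  · have : (F z - M) / h z ≤ sSup A := le_csSup hbdd ⟨z, ⟨hz, h0⟩, rfl⟩
    rw [div_le_iff₀ h0] at this
    linarith

theorem exists_multipliers_of_neg {h : ι → E → ℝ} (J : Finset ι) (hF : ConcaveOn ℝ D F)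
    (hh : ∀ i ∈ J, ConvexOn ℝ D (h i)) (hx₀ : x₀ ∈ D) (hneg : ∀ i ∈ J, h i x₀ < 0)
    (hM : ∀ z ∈ D, (∀ i ∈ J, h i z ≤ 0) → F z ≤ M) :
    ∃ μ : ι → ℝ, (∀ i ∈ J, 0 ≤ μ i) ∧ ∀ z ∈ D, F z - ∑ i ∈ J, μ i * h i z ≤ M := by
  induction J using Finset.induction_on generalizing F with
  | empty => exact ⟨0, by simp, fun z hz => by simpa using hM z hz (by simp)⟩
  | insert a J ha ih =>
    have hconv : Convex ℝ {z | z ∈ D ∧ ∀ i ∈ J, h i z ≤ 0} := by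
      intro x hx y hy s t hs ht hst
      refine ⟨hF.1 hx.1 hy.1 hs ht hst, fun i hi => ?_⟩
      refine ((hh i (by simp [hi])).2 hx.1 hy.1 hs ht hst).trans ?_
      have h1 := mul_nonpos_of_nonneg_of_nonpos hs (hx.2 i hi)
      have h2 := mul_nonpos_of_nonneg_of_nonpos ht (hy.2 i hi)
      simp only [smul_eq_mul]
      linarith
    have hsub : {z | z ∈ D ∧ ∀ i ∈ J, h i z ≤ 0} ⊆ D := fun z hz => hz.1
    obtain ⟨m, hm0, hm⟩ := exists_multiplier_of_neg (hF.subset hsub hconv)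
      ((hh a (by simp)).subset hsub hconv) ⟨hx₀, fun i hi => (hneg i (by simp [hi])).le⟩
      (hneg a (by simp)) (M := M) (fun z hz hz0 => hM z hz.1 (by
        intro i hi
        rcases Finset.mem_insert.1 hi with rfl | hi
        · exact hz0
        · exact hz.2 i hi))
    obtain ⟨μ, hμ0, hμ⟩ := ih (F := fun z => F z - m * h a z)
      (hF.sub_mul_convexOn (hh a (by simp)) hm0) (fun i hi => hh i (by simp [hi]))
      (fun i hi => hneg i (by simp [hi])) (fun z hz hz' => hm z ⟨hz, hz'⟩)
    have hupd : ∀ i ∈ J, Function.update μ a m i = μ i := fun i hi =>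
      Function.update_of_ne (ne_of_mem_of_not_mem hi ha) _ _
    refine ⟨Function.update μ a m, fun i hi => ?_, fun z hz => ?_⟩
    · rcases Finset.mem_insert.1 hi with rfl | hi
      · simpa using hm0
      · rw [hupd i hi]; exact hμ0 i hi
    · rw [Finset.sum_insert ha, Function.update_self,
        Finset.sum_congr rfl (fun i hi => by rw [hupd i hi])]
      linarith [hμ z hz]

theorem exists_multipliers_of_eq {h : ι → E → ℝ} (J : Finset ι) (hF : ConcaveOn ℝ D F)
    (hh : ∀ i ∈ J, IsAff (h i)) (hcore : IsCorePoint D x₀) (h0 : ∀ i ∈ J, h i x₀ = 0)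
    (hM : ∀ z ∈ D, (∀ i ∈ J, h i z = 0) → F z ≤ M) :
    ∃ μ : ι → ℝ, ∀ z ∈ D, F z - ∑ i ∈ J, μ i * h i z ≤ M := by
  induction J using Finset.induction_on generalizing F with
  | empty => exact ⟨0, fun z hz => by simpa using hM z hz (by simp)⟩
  | insert a J ha ih =>
    have hconv : Convex ℝ {z | z ∈ D ∧ ∀ i ∈ J, h i z = 0} := by
      intro x hx y hy s t hs ht hst
      refine ⟨hF.1 hx.1 hy.1 hs ht hst, fun i hi => ?_⟩
      rw [hh i (by simp [hi]) x y s t hst, hx.2 i hi, hy.2 i hi]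
      simp
    have hcore' : IsCorePoint {z | z ∈ D ∧ ∀ i ∈ J, h i z = 0} x₀ := by
      refine ⟨⟨hcore.1, fun i hi => h0 i (by simp [hi])⟩, fun z hz => ?_⟩
      obtain ⟨w, hw, s, t, hs, ht, hst, hx⟩ := hcore.2 z hz.1
      refine ⟨w, ⟨hw, fun i hi => ?_⟩, s, t, hs, ht, hst, hx⟩
      have h1 := hh i (by simp [hi]) w z s t hst
      rw [hx, h0 i (by simp [hi]), hz.2 i hi] at h1
      have h2 : s * h i w = 0 := by linarith
      exact (mul_eq_zero.1 h2).resolve_left hs.ne'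
    obtain ⟨m, hm⟩ := exists_multiplier_of_eq (hF.subset (fun z hz => hz.1) hconv)
      (hh a (by simp)) hcore' (h0 a (by simp)) (M := M) (fun z hz hz0 => hM z hz.1 (by
        intro i hi
        rcases Finset.mem_insert.1 hi with rfl | hi
        · exact hz0
        · exact hz.2 i hi))
    obtain ⟨μ, hμ⟩ := ih (F := fun z => F z - m * h a z)
      (hF.sub_mul_isAff (hh a (by simp)) m) (fun i hi => hh i (by simp [hi]))
      (fun i hi => h0 i (by simp [hi])) (fun z hz hz' => hm z ⟨hz, hz'⟩)
    have hupd : ∀ i ∈ J, Function.update μ a m i = μ i := fun i hi =>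
      Function.update_of_ne (ne_of_mem_of_not_mem hi ha) _ _
    refine ⟨Function.update μ a m, fun z hz => ?_⟩
    rw [Finset.sum_insert ha, Function.update_self,
      Finset.sum_congr rfl (fun i hi => by rw [hupd i hi])]
    linarith [hμ z hz]

/-- Nonnegative multipliers for affine inequalities need no strict feasibility, only a feasible
algebraic relative interior point of the ground set. -/
theorem exists_multipliers_of_isAff {h : ι → E → ℝ} (hcore : IsCorePoint D x₀) (J : Finset ι)
    (hh : ∀ i ∈ J, IsAff (h i)) (h0 : ∀ i ∈ J, h i x₀ ≤ 0) (F : E → ℝ) (M : ℝ)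
    (hF : ConcaveOn ℝ D F) (hM : ∀ z ∈ D, (∀ i ∈ J, h i z ≤ 0) → F z ≤ M) :
    ∃ μ : ι → ℝ, (∀ i ∈ J, 0 ≤ μ i) ∧ ∀ z ∈ D, F z - ∑ i ∈ J, μ i * h i z ≤ M := by
  induction J using Finset.strongInduction generalizing F M with
  | H J ih =>
  have split : ∀ k ∈ J, ∀ z, (∀ i ∈ J.erase k, h i z ≤ 0) → h k z ≤ 0 → ∀ i ∈ J, h i z ≤ 0 := by
    intro k _ z hz hk i hi
    by_cases hik : i = k
    · rw [hik]; exact hk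
    · exact hz i (Finset.mem_erase.2 ⟨hik, hi⟩)
  have sum_update : ∀ k ∈ J, ∀ (μ : ι → ℝ) (m : ℝ) (z : E),
      ∑ i ∈ J, Function.update μ k m i * h i z = m * h k z + ∑ i ∈ J.erase k, μ i * h i z := by
    intro k hk μ m z
    rw [← Finset.add_sum_erase J _ hk, Function.update_self]
    congr 1
    exact Finset.sum_congr rfl fun i hi => by
      rw [Function.update_of_ne (Finset.ne_of_mem_erase hi)]
  by_cases hcase : ∃ k ∈ J, ∃ z ∈ D, (∀ i ∈ J, h i z ≤ 0) ∧ h k z < 0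
  · obtain ⟨k, hk, z₁, hz₁, hz₁f, hz₁k⟩ := hcase
    have hconv : Convex ℝ {z | z ∈ D ∧ ∀ i ∈ J.erase k, h i z ≤ 0} := by
      intro x hx y hy s t hs ht hst
      refine ⟨hF.1 hx.1 hy.1 hs ht hst, fun i hi => ?_⟩
      rw [hh i (Finset.mem_of_mem_erase hi) x y s t hst]
      have h1 := mul_nonpos_of_nonneg_of_nonpos hs (hx.2 i hi)
      have h2 := mul_nonpos_of_nonneg_of_nonpos ht (hy.2 i hi)
      linarith
    obtain ⟨m, hm0, hm⟩ := exists_multiplier_of_neg (hF.subset (fun z hz => hz.1) hconv)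
      ((hh k hk).convexOn hconv)
      ⟨hz₁, fun i hi => hz₁f i (Finset.mem_of_mem_erase hi)⟩ hz₁k (M := M)
      (fun z hz hz0 => hM z hz.1 (split k hk z hz.2 hz0))
    obtain ⟨μ, hμ0, hμ⟩ := ih (J.erase k) (Finset.erase_ssubset hk)
      (fun i hi => hh i (Finset.mem_of_mem_erase hi))
      (fun i hi => h0 i (Finset.mem_of_mem_erase hi)) (fun z => F z - m * h k z) M
      (hF.sub_mul_isAff (hh k hk) m) (fun z hz hz' => hm z ⟨hz, hz'⟩)
    refine ⟨Function.update μ k m, fun i hi => ?_, fun z hz => ?_⟩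
    · by_cases hik : i = k
      · rw [hik]; simpa using hm0
      · rw [Function.update_of_ne hik]; exact hμ0 i (Finset.mem_erase.2 ⟨hik, hi⟩)
    · rw [sum_update k hk]
      linarith [hμ z hz]
  · push Not at hcase
    have hfarkas : ∀ k, ∃ κ : ι → ℝ, k ∈ J → (∀ i ∈ J, 0 ≤ κ i) ∧ κ k = 1 ∧
        ∀ z ∈ D, 0 ≤ ∑ i ∈ J, κ i * h i z := by
      intro k
      by_cases hk : k ∈ J
      swap
      · exact ⟨0, fun h => absurd h hk⟩
      obtain ⟨κ, hκ0, hκ⟩ := ih (J.erase k) (Finset.erase_ssubset hk)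
        (fun i hi => hh i (Finset.mem_of_mem_erase hi))
        (fun i hi => h0 i (Finset.mem_of_mem_erase hi)) (fun z => 0 - 1 * h k z) 0
        ((concaveOn_const 0 hF.1).sub_mul_isAff (hh k hk) 1) (fun z hz hz' => by
          by_contra hcon
          have hneg : h k z < 0 := by linarith
          exact absurd (hcase k hk z hz (split k hk z hz' hneg.le)) (by linarith))
      refine ⟨Function.update κ k 1, fun _ => ⟨fun i hi => ?_, Function.update_self .., ?_⟩⟩
      · by_cases hik : i = k
        · rw [hik]; simp
        · rw [Function.update_of_ne hik]; exact hκ0 i (Finset.mem_erase.2 ⟨hik, hi⟩)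
      · intro z hz
        rw [sum_update k hk]
        linarith [hκ z hz]
    choose κ hκ using hfarkas
    obtain ⟨μ, hμ⟩ := exists_multipliers_of_eq J hF hh hcore
      (fun i hi => le_antisymm (h0 i hi) (hcase i hi x₀ hcore.1 h0)) (M := M)
      (fun z hz hz0 => hM z hz fun i hi => (hz0 i hi).le)
    obtain ⟨s, hs⟩ : ∃ s : ℝ, s = ∑ i ∈ J, |μ i| := ⟨_, rfl⟩
    have hs0 : 0 ≤ s := hs ▸ Finset.sum_nonneg fun i _ => abs_nonneg _
    refine ⟨fun i => μ i + s * ∑ k ∈ J, κ k i, fun i hi => ?_, fun z hz => ?_⟩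
    · have h1 : (1 : ℝ) ≤ ∑ k ∈ J, κ k i := by
        rw [← (hκ i hi).2.1]
        exact Finset.single_le_sum (f := fun k => κ k i) (fun k hk => (hκ k hk).1 i hi) hi
      have h2 : |μ i| ≤ s := hs ▸ Finset.single_le_sum (f := fun i => |μ i|)
        (fun k _ => abs_nonneg _) hi
      have h3 : s * 1 ≤ s * ∑ k ∈ J, κ k i := mul_le_mul_of_nonneg_left h1 hs0
      linarith [neg_abs_le (μ i)]
    · have h1 : 0 ≤ ∑ k ∈ J, ∑ i ∈ J, κ k i * h i z :=
        Finset.sum_nonneg fun k hk => (hκ k hk).2.2 z hz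
      have h2 : ∑ i ∈ J, (μ i + s * ∑ k ∈ J, κ k i) * h i z
          = ∑ i ∈ J, μ i * h i z + s * ∑ k ∈ J, ∑ i ∈ J, κ k i * h i z := by
        rw [Finset.sum_comm, Finset.mul_sum (s := J) (a := s), ← Finset.sum_add_distrib]
        refine Finset.sum_congr rfl fun i _ => ?_
        rw [add_mul, mul_assoc, Finset.sum_mul]
      rw [h2]
      linarith [hμ z hz, mul_nonneg hs0 h1]

end Multipliers

section DotProduct

variable {n : ℕ}

theorem dotp_comm (x y : Fin n → ℝ) : dotp x y = dotp y x := by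
  simp only [dotp, mul_comm]

theorem dotp_add_left (x y z : Fin n → ℝ) : dotp (x + y) z = dotp x z + dotp y z := by
  simp only [dotp, Pi.add_apply, add_mul, Finset.sum_add_distrib]

theorem dotp_smul_left (a : ℝ) (x y : Fin n → ℝ) : dotp (a • x) y = a * dotp x y := by
  simp only [dotp, Pi.smul_apply, smul_eq_mul, mul_assoc, Finset.mul_sum]

theorem dotp_neg_left (x y : Fin n → ℝ) : dotp (-x) y = -dotp x y := by
  simp [dotp]

theorem dotp_sub_right (x y z : Fin n → ℝ) : dotp x (y - z) = dotp x y - dotp x z := by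
  simp only [dotp, Pi.sub_apply, mul_sub, Finset.sum_sub_distrib]

theorem dotp_sum_left {ι : Type*} (s : Finset ι) (x : ι → Fin n → ℝ) (y : Fin n → ℝ) :
    dotp (∑ i ∈ s, x i) y = ∑ i ∈ s, dotp (x i) y := by
  simp only [dotp, Finset.sum_apply, Finset.sum_mul]
  exact Finset.sum_comm

theorem exists_dotp_eq (ψ : (Fin n → ℝ) →ₗ[ℝ] ℝ) : ∃ a : Fin n → ℝ, ∀ v, ψ v = dotp a v := by
  refine ⟨fun i => ψ (fun j => if i = j then 1 else 0), fun v => ?_⟩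
  rw [ψ.pi_apply_eq_sum_univ v]
  simp only [dotp, smul_eq_mul, mul_comm]

theorem dotp_affine_combination (a x y : Fin n → ℝ) (s t b : ℝ) (hst : s + t = 1) :
    dotp a (s • x + t • y) + b = s * (dotp a x + b) + t * (dotp a y + b) := by
  rw [dotp_comm a, dotp_add_left, dotp_smul_left, dotp_smul_left, dotp_comm x, dotp_comm y]
  linear_combination -b * hst

end DotProduct

theorem EReal.coe_finset_sum_real {ι : Type*} (s : Finset ι) (g : ι → ℝ) :
    ((∑ i ∈ s, g i : ℝ) : EReal) = ∑ i ∈ s, (g i : EReal) := by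
  induction s using Finset.induction_on with
  | empty => simp
  | insert a s ha ih => rw [Finset.sum_insert ha, Finset.sum_insert ha, EReal.coe_add, ih]

section ConvexFunctions

variable {n : ℕ} {h : (Fin n → ℝ) → EReal}

theorem ConvexFn.combo_le (hc : ConvexFn h) {x y : Fin n → ℝ} {r s a b : ℝ}
    (hx : h x ≤ r) (hy : h y ≤ s) (ha : 0 ≤ a) (hb : 0 ≤ b) (hab : a + b = 1) :
    h (a • x + b • y) ≤ ((a * r + b * s : ℝ) : EReal) :=
  hc (x := (x, r)) hx (y := (y, s)) hy ha hb hab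

theorem coe_toReal_of_mem_edom (hp : ProperFn h) {z : Fin n → ℝ} (hz : z ∈ edom h) :
    (((h z).toReal : ℝ) : EReal) = h z :=
  EReal.coe_toReal (ne_of_lt hz) (hp.1 z)

theorem ConvexFn.convex_edom (hc : ConvexFn h) (hp : ProperFn h) : Convex ℝ (edom h) := by
  intro x hx y hy a b ha hb hab
  exact (hc.combo_le (coe_toReal_of_mem_edom hp hx).ge (coe_toReal_of_mem_edom hp hy).ge
    ha hb hab).trans_lt (EReal.coe_lt_top _)

theorem ClosedFn.isClosed_real_epigraph (hc : ClosedFn h) :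
    IsClosed {p : (Fin n → ℝ) × ℝ | h p.1 ≤ (p.2 : EReal)} :=
  hc.1.isClosed_epigraph.preimage
    (continuous_fst.prodMk (continuous_coe_real_ereal.comp continuous_snd))

/-- A proper closed convex function has an affine minorant. -/
theorem exists_affine_minorant (hp : ProperFn h) (hcl : ClosedFn h) (hc : ConvexFn h) :
    ∃ (v : Fin n → ℝ) (b : ℝ), ∀ (z : Fin n → ℝ) (r : ℝ), h z ≤ r → dotp v z - b ≤ r := by
  obtain ⟨x₀, hx₀⟩ := hp.2
  have hx₀' := coe_toReal_of_mem_edom hp (lt_top_iff_ne_top.2 hx₀)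
  obtain ⟨r₀, hr₀⟩ : ∃ r₀ : ℝ, (r₀ : EReal) = h x₀ := ⟨_, hx₀'⟩
  obtain ⟨φ, u, hu, hφ⟩ := geometric_hahn_banach_point_closed hc hcl.isClosed_real_epigraph
    (x := (x₀, r₀ - 1)) (by
      simp only [Set.mem_ofPred_eq, not_le, ← hr₀]
      exact_mod_cast sub_one_lt r₀)
  obtain ⟨a, ha⟩ := exists_dotp_eq ((φ : ((Fin n → ℝ) × ℝ) →ₗ[ℝ] ℝ) ∘ₗ LinearMap.inl ℝ _ _)
  have hdec : ∀ z r, φ (z, r) = dotp a z + r * φ (0, 1) := by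
    intro z r
    have h1 : ((z, r) : (Fin n → ℝ) × ℝ) = (z, 0) + r • (0, 1) := by simp
    rw [h1, map_add, map_smul, smul_eq_mul]
    exact congrArg (· + r * φ (0, 1)) (ha z)
  have h0 := hu.trans (hφ (x₀, r₀) hr₀.ge)
  rw [hdec x₀, hdec x₀] at h0
  have hβ : 0 < φ (0, 1) := by linarith
  set β := φ (0, 1)
  refine ⟨(-β⁻¹) • a, -(u / β), fun z r hz => ?_⟩
  have h1 := hφ (z, r) hz
  rw [hdec z] at h1
  rw [dotp_smul_left]
  have h2 : (u - dotp a z) / β ≤ r := by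
    rw [div_le_iff₀ hβ]; linarith
  refine le_of_eq_of_le ?_ h2
  field_simp
  ring

theorem dotp_le_persp_conjFn {z : Fin n → ℝ} (hp : ProperFn h) (hz : h z ≤ 0) (y : Fin n → ℝ)
    {ν : ℝ} (hν : 0 ≤ ν) : ((dotp y z : ℝ) : EReal) ≤ persp (conjFn h) y ν := by
  unfold persp
  split_ifs with hpos
  · have h1 : ((dotp (ν⁻¹ • y) z : ℝ) : EReal) ≤ conjFn h (ν⁻¹ • y) := by
      refine le_trans ?_ (le_iSup _ z)
      simpa using EReal.sub_le_sub (le_refl ((dotp (ν⁻¹ • y) z : ℝ) : EReal)) hz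
    have h2 := mul_le_mul_of_nonneg_left h1 (EReal.coe_nonneg.2 hν)
    refine le_of_eq_of_le ?_ h2
    rw [← EReal.coe_mul, dotp_smul_left]
    congr 1
    field_simp
  · rw [dotp_comm]
    refine le_iSup₂_of_le z ?_ le_rfl
    have hz' := coe_toReal_of_mem_edom hp (hz.trans_lt EReal.zero_lt_top)
    refine lt_of_le_of_lt (iSup_le fun w => ?_) (EReal.coe_lt_top (h z).toReal)
    have h1 : ((dotp w z - (h z).toReal : ℝ) : EReal) ≤ conjFn h w := by
      refine le_trans ?_ (le_iSup _ z)
      rw [EReal.coe_sub, hz']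
    refine (EReal.sub_le_sub le_rfl h1).trans ?_
    rw [← EReal.coe_sub, dotp_comm w]
    simp

theorem conjFn_le {w : Fin n → ℝ} {B : ℝ} (hp : ProperFn h)
    (hB : ∀ (z : Fin n → ℝ) (r : ℝ), h z ≤ r → dotp w z - r ≤ B) : conjFn h w ≤ B := by
  refine iSup_le fun z => ?_
  by_cases hz : h z = ⊤
  · simp [hz]
  · have hz' := coe_toReal_of_mem_edom hp (lt_top_iff_ne_top.2 hz)
    rw [← hz', ← EReal.coe_sub]
    exact EReal.coe_le_coe_iff.2 (hB z _ hz'.ge)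

theorem persp_conjFn_le (hp : ProperFn h) (hcl : ClosedFn h) (hc : ConvexFn h) {y : Fin n → ℝ}
    {ν B : ℝ} (hν : 0 ≤ ν) (hB : ∀ (z : Fin n → ℝ) (r : ℝ), h z ≤ r → dotp y z - ν * r ≤ B) :
    persp (conjFn h) y ν ≤ B := by
  unfold persp
  split_ifs with hpos
  · have h1 : conjFn h (ν⁻¹ • y) ≤ ((ν⁻¹ * B : ℝ) : EReal) := by
      refine conjFn_le hp fun z r hz => ?_
      have := mul_le_mul_of_nonneg_left (hB z r hz) (inv_nonneg.2 hν)
      rw [dotp_smul_left]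
      refine le_of_eq_of_le ?_ this
      field_simp
    refine (mul_le_mul_of_nonneg_left h1 (EReal.coe_nonneg.2 hν)).trans (le_of_eq ?_)
    rw [← EReal.coe_mul]
    congr 1
    field_simp
  · have hν0 : ν = 0 := le_antisymm (not_lt.1 hpos) hν
    obtain ⟨v, b, hv⟩ := exists_affine_minorant hp hcl hc
    refine iSup₂_le fun w hw => EReal.coe_le_coe_iff.2 ?_
    by_contra hcon
    push Not at hcon
    rw [dotp_comm] at hcon
    have hray : ∀ t : ℝ, 0 ≤ t → conjFn h (v + t • y) ≤ ((b + t * B : ℝ) : EReal) := by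
      intro t ht
      refine conjFn_le hp fun z r hz => ?_
      have h1 := hv z r hz
      have h2 := mul_le_mul_of_nonneg_left (hB z r hz) ht
      rw [hν0] at h2
      rw [dotp_add_left, dotp_smul_left]
      linarith
    have hlow : ∀ t : ℝ, 0 ≤ t →
        ((dotp v w + t * dotp y w - (b + t * B) : ℝ) : EReal) ≤ conjFn (conjFn h) w := by
      intro t ht
      refine le_trans ?_ (le_iSup _ (v + t • y))
      rw [dotp_comm w, dotp_add_left, dotp_smul_left, EReal.coe_sub]
      exact EReal.sub_le_sub le_rfl (hray t ht)
    have hbot : conjFn (conjFn h) w ≠ ⊥ := by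
      intro hb
      have := hlow 0 le_rfl
      rw [hb] at this
      exact absurd (le_bot_iff.1 this) (EReal.coe_ne_bot _)
    obtain ⟨m, hm⟩ : ∃ m : ℝ, (m : EReal) = conjFn (conjFn h) w :=
      ⟨_, EReal.coe_toReal (ne_of_lt hw) hbot⟩
    have hlow' : ∀ t : ℝ, 0 ≤ t → dotp v w - b + t * (dotp y w - B) ≤ m := by
      intro t ht
      have := hlow t ht
      rw [← hm, EReal.coe_le_coe_iff] at this
      linarith
    have hd : 0 < dotp y w - B := by linarith
    have h1 := hlow' ((|m - (dotp v w - b)| + 1) / (dotp y w - B)) (by positivity)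
    rw [div_mul_cancel₀ _ hd.ne'] at h1
    linarith [le_abs_self (m - (dotp v w - b))]

/-- Points near a relative interior point on a line through a second point of the set. -/
theorem eventually_mem_of_mem_intrinsicInterior {E : Type*} [NormedAddCommGroup E]
    [NormedSpace ℝ E] {s : Set E} {x z : E} (hx : x ∈ intrinsicInterior ℝ s) (hz : z ∈ s) :
    ∀ᶠ t in nhds (0 : ℝ), x + t • (x - z) ∈ s := by
  obtain ⟨p, hp, rfl⟩ := mem_intrinsicInterior.1 hx
  let γ : ℝ → affineSpan ℝ s := fun t =>
    ⟨AffineMap.lineMap (p : E) z (-t), AffineMap.lineMap_mem _ p.2 (subset_affineSpan ℝ s hz)⟩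
  have hγ : Continuous γ :=
    Continuous.subtype_mk (AffineMap.lineMap_continuous.comp continuous_neg) _
  have hγ0 : γ 0 = p := Subtype.ext (by simp [γ])
  have hmem : Subtype.val ⁻¹' s ∈ nhds (γ 0) := hγ0.symm ▸ mem_interior_iff_mem_nhds.1 hp
  have hev : ∀ᶠ t in nhds (0 : ℝ), γ t ∈ Subtype.val ⁻¹' s := hγ.continuousAt hmem
  filter_upwards [hev] with t ht
  have h1 : (γ t : E) ∈ s := ht
  have h2 : (γ t : E) = (p : E) + t • ((p : E) - z) := by
    simp only [γ, AffineMap.lineMap_apply, vsub_eq_sub, vadd_eq_add]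
    module
  rwa [← h2]

end ConvexFunctions

/-- A bound on all values of a separable sum splits into bounds on the summands. -/
theorem exists_separate_bounds {ι β : Type*} [Fintype ι] {S : ι → Set β} {B : ι → β → ℝ} {M : ℝ}
    (hS : ∀ i, (S i).Nonempty) (hM : ∀ b : ι → β, (∀ i, b i ∈ S i) → ∑ i, B i (b i) ≤ M) :
    ∃ m : ι → ℝ, (∀ i, ∀ b ∈ S i, B i b ≤ m i) ∧ ∑ i, m i ≤ M := by
  choose b₁ hb₁ using hS
  have hbdd : ∀ i, BddAbove (B i '' S i) := by
    intro i
    refine ⟨M - ∑ j ∈ Finset.univ.erase i, B j (b₁ j), ?_⟩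
    rintro _ ⟨b, hb, rfl⟩
    have h1 := hM (Function.update b₁ i b) (by
      intro j
      by_cases hj : j = i
      · subst hj; simpa using hb
      · rw [Function.update_of_ne hj]; exact hb₁ j)
    rw [← Finset.add_sum_erase _ _ (Finset.mem_univ i), Function.update_self,
      Finset.sum_congr rfl (fun j hj => by
        rw [Function.update_of_ne (Finset.ne_of_mem_erase hj)])] at h1
    linarith
  refine ⟨fun i => sSup (B i '' S i), fun i b hb => le_csSup (hbdd i) ⟨b, hb, rfl⟩, ?_⟩
  refine le_of_forall_pos_le_add fun ε hε => ?_
  have hδ : 0 < ε / (Fintype.card ι + 1) := by positivity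
  have hex : ∀ i, ∃ b ∈ S i, sSup (B i '' S i) ≤ B i b + ε / (Fintype.card ι + 1) := by
    intro i
    obtain ⟨_, ⟨b, hb, rfl⟩, hlt⟩ := exists_lt_of_lt_csSup
      (Set.Nonempty.image (B i) ⟨b₁ i, hb₁ i⟩) (sub_lt_self (sSup (B i '' S i)) hδ)
    exact ⟨b, hb, by linarith⟩
  choose b hb hle using hex
  calc ∑ i, sSup (B i '' S i) ≤ ∑ i, (B i (b i) + ε / (Fintype.card ι + 1)) :=
        Finset.sum_le_sum fun i _ => hle i
    _ = ∑ i, B i (b i) + Fintype.card ι * (ε / (Fintype.card ι + 1)) := by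
        rw [Finset.sum_add_distrib, Finset.sum_const, Finset.card_univ, nsmul_eq_mul]
    _ ≤ M + ε := by
        refine add_le_add (hM b hb) ?_
        rw [← mul_div_assoc, div_le_iff₀ (by positivity)]
        nlinarith

theorem dotp_zero_right {n : ℕ} (x : Fin n → ℝ) : dotp x 0 = 0 := by
  simp [dotp]

section LagrangeDuality

variable {n k : ℕ} {g : (Fin n → ℝ) → ℝ} {c : Fin k → (Fin n → ℝ) → EReal} {M : ℝ}

/-- `η` and `ν` are multipliers certifying that `g ≤ M` on the set `c ≤ 0`, for the problem in
which every constraint function has its own copy of the decision vector. -/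
def IsSplitCertificate (g : (Fin n → ℝ) → ℝ) (c : Fin k → (Fin n → ℝ) → EReal) (M : ℝ)
    (η : Fin k → Fin n → ℝ) (ν : Fin k → ℝ) : Prop :=
  (∀ ℓ, 0 ≤ ν ℓ) ∧ ∀ (z : Fin n → ℝ) (Z : Fin k → Fin n → ℝ) (r : Fin k → ℝ),
    (∀ ℓ, c ℓ (Z ℓ) ≤ r ℓ) → g z - ∑ ℓ, (ν ℓ * r ℓ + dotp (η ℓ) (Z ℓ - z)) ≤ M

theorem exists_splitCertificate_of_slater (hg : ConcaveOn ℝ Set.univ g) (hC : AssumptionC c)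
    {zS : Fin n → ℝ} (hS : SlaterZ c zS) (hM : ∀ z ∈ Zset c, g z ≤ M) :
    ∃ η ν, IsSplitCertificate g c M η ν := by
  set D : Set (Fin (k + 1) → Fin n → ℝ) := {Z | ∀ ℓ : Fin k, Z ℓ.succ ∈ edom (c ℓ)} with hD
  set F : (Fin (k + 1) → Fin n → ℝ) → ℝ := fun Z => g (Z 0) with hF
  set h : Fin k → (Fin (k + 1) → Fin n → ℝ) → ℝ := fun ℓ Z => (c ℓ (Z ℓ.succ)).toReal with hh
  set e : Fin k × Fin n → (Fin (k + 1) → Fin n → ℝ) → ℝ :=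
    fun q Z => Z q.1.succ q.2 - Z 0 q.2 with he
  set A : Finset (Fin k) := Finset.univ.filter fun ℓ => IsAffineFn (c ℓ) with hA
  have hDconv : Convex ℝ D := fun X hX Y hY a b ha hb hab ℓ =>
    (hC ℓ).2.2.convex_edom (hC ℓ).1 (hX ℓ) (hY ℓ) ha hb hab
  have hFconc : ConcaveOn ℝ D F :=
    ⟨hDconv, fun X _ Y _ a b ha hb hab => hg.2 (Set.mem_univ _) (Set.mem_univ _) ha hb hab⟩
  have hcoe : ∀ Z ∈ D, ∀ ℓ, ((h ℓ Z : ℝ) : EReal) = c ℓ (Z ℓ.succ) := fun Z hZ ℓ =>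
    coe_toReal_of_mem_edom (hC ℓ).1 (hZ ℓ)
  have hhconv : ∀ ℓ, ConvexOn ℝ D (h ℓ) := by
    refine fun ℓ => ⟨hDconv, fun X hX Y hY a b ha hb hab => ?_⟩
    have h1 := (hC ℓ).2.2.combo_le (hcoe X hX ℓ).ge (hcoe Y hY ℓ).ge ha hb hab
    have h2 := hcoe _ (hDconv hX hY ha hb hab) ℓ
    exact EReal.coe_le_coe_iff.1 (h2.le.trans h1)
  have haff : ∀ ℓ ∈ A, IsAff (h ℓ) := by
    intro ℓ hℓ X Y s t hst
    obtain ⟨a, b, hab⟩ := (Finset.mem_filter.1 hℓ).2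
    simp only [hh, hab, EReal.toReal_coe, Pi.add_apply, Pi.smul_apply]
    exact dotp_affine_combination a _ _ s t b hst
  have heaff : ∀ q, IsAff (e q) := by
    intro q X Y s t _
    simp only [he, Pi.add_apply, Pi.smul_apply, smul_eq_mul]
    ring
  set D' : Set (Fin (k + 1) → Fin n → ℝ) := {Z | Z ∈ D ∧ ∀ q, e q Z = 0} with hD'
  have hD'conv : Convex ℝ D' := by
    intro X hX Y hY s t hs ht hst
    refine ⟨hDconv hX.1 hY.1 hs ht hst, fun q => ?_⟩
    rw [heaff q X Y s t hst, hX.2 q, hY.2 q]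
    simp
  have hD'D : D' ⊆ D := fun Z hZ => hZ.1
  have hdiag : ∀ Z, (∀ q, e q Z = 0) → ∀ ℓ : Fin k, Z ℓ.succ = Z 0 := fun Z hZ ℓ =>
    funext fun i => sub_eq_zero.1 (hZ (ℓ, i))
  set XS : Fin (k + 1) → Fin n → ℝ := fun _ => zS with hXS
  have hXSD : XS ∈ D := fun ℓ => intrinsicInterior_subset (hS.1 ℓ)
  have hcore : IsCorePoint D XS := by
    refine ⟨hXSD, fun Z hZ => ?_⟩
    have hev : ∀ᶠ t in nhdsWithin (0 : ℝ) (Set.Ioi 0),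
        (∀ ℓ : Fin k, zS + t • (zS - Z ℓ.succ) ∈ edom (c ℓ)) ∧ 0 < t :=
      ((Filter.eventually_all.2 fun ℓ =>
        eventually_mem_of_mem_intrinsicInterior (hS.1 ℓ) (hZ ℓ)).filter_mono
          nhdsWithin_le_nhds).and self_mem_nhdsWithin
    obtain ⟨t, ht, ht0⟩ := hev.exists
    refine ⟨XS + t • (XS - Z), fun ℓ => ht ℓ, 1 / (1 + t), t / (1 + t), by positivity,
      by positivity, by field_simp, ?_⟩
    ext j i
    simp only [Pi.add_apply, Pi.smul_apply, Pi.sub_apply, smul_eq_mul]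
    field_simp
    ring
  have heXS : ∀ q, e q XS = 0 := fun q => sub_self _
  have hcore' : IsCorePoint D' XS := by
    refine ⟨⟨hXSD, heXS⟩, fun Z hZ => ?_⟩
    obtain ⟨W, hW, s, t, hs, ht, hst, hx⟩ := hcore.2 Z hZ.1
    refine ⟨W, ⟨hW, fun q => ?_⟩, s, t, hs, ht, hst, hx⟩
    have h1 := heaff q W Z s t hst
    rw [hx, heXS, hZ.2 q] at h1
    have h2 : s * e q W = 0 := by linarith
    exact (mul_eq_zero.1 h2).resolve_left hs.ne'
  have hXSle : ∀ ℓ, h ℓ XS ≤ 0 := fun ℓ =>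
    EReal.coe_le_coe_iff.1 ((hcoe XS hXSD ℓ).le.trans (hS.2.1 ℓ))
  -- The nonlinear constraints are removed first, then the affine ones, then the copies are split.
  set D₁ : Set (Fin (k + 1) → Fin n → ℝ) := {Z | Z ∈ D' ∧ ∀ ℓ ∈ A, h ℓ Z ≤ 0} with hD₁
  have hD₁conv : Convex ℝ D₁ := by
    intro X hX Y hY s t hs ht hst
    refine ⟨hD'conv hX.1 hY.1 hs ht hst, fun ℓ hℓ => ?_⟩
    rw [haff ℓ hℓ X Y s t hst]
    have h1 := mul_nonpos_of_nonneg_of_nonpos hs (hX.2 ℓ hℓ)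
    have h2 := mul_nonpos_of_nonneg_of_nonpos ht (hY.2 ℓ hℓ)
    linarith
  have hD₁D : D₁ ⊆ D := fun Z hZ => hZ.1.1
  obtain ⟨μ₁, hμ₁0, hμ₁⟩ := exists_multipliers_of_neg (h := h) (M := M) Aᶜ
    (hFconc.subset hD₁D hD₁conv) (fun ℓ _ => (hhconv ℓ).subset hD₁D hD₁conv)
    (x₀ := XS) ⟨hcore'.1, fun ℓ _ => hXSle ℓ⟩ (by
      intro ℓ hℓ
      have hna : ¬ IsAffineFn (c ℓ) := fun hcon => by simp [hA, hcon] at hℓ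
      exact EReal.coe_lt_coe_iff.1 ((hcoe XS hXSD ℓ).trans_lt (hS.2.2 ℓ hna)))
    (by
      intro Z hZ hle
      refine hM _ fun ℓ => ?_
      have h1 : h ℓ Z ≤ 0 := by
        by_cases hℓ : ℓ ∈ A
        · exact hZ.2 ℓ hℓ
        · exact hle ℓ (Finset.mem_compl.2 hℓ)
      rw [← hdiag Z hZ.1.2 ℓ, ← hcoe Z hZ.1.1 ℓ]
      exact EReal.coe_le_coe_iff.2 h1)
  have hF₁ := hFconc.sub_sum_mul_convexOn Aᶜ (fun ℓ _ => hhconv ℓ) hμ₁0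
  obtain ⟨μ₂, hμ₂0, hμ₂⟩ := exists_multipliers_of_isAff hcore' A haff (fun ℓ _ => hXSle ℓ) _ M
    (hF₁.subset hD'D hD'conv) (fun Z hZ hle => hμ₁ Z ⟨hZ, hle⟩)
  have hF₂ := hF₁.sub_sum_mul_convexOn A (fun ℓ _ => hhconv ℓ) hμ₂0
  obtain ⟨ζ, hζ⟩ := exists_multipliers_of_eq Finset.univ hF₂ (fun q _ => heaff q) hcore
    (fun q _ => heXS q) (fun Z hZ hq => hμ₂ Z ⟨hZ, fun q => hq q (Finset.mem_univ q)⟩)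
  refine ⟨fun ℓ i => ζ (ℓ, i), fun ℓ => if ℓ ∈ A then μ₂ ℓ else μ₁ ℓ, fun ℓ => ?_,
    fun z Z r hr => ?_⟩
  · dsimp only
    split_ifs with hℓ
    · exact hμ₂0 ℓ hℓ
    · exact hμ₁0 ℓ (Finset.mem_compl.2 hℓ)
  have hν0 : ∀ ℓ, 0 ≤ (if ℓ ∈ A then μ₂ ℓ else μ₁ ℓ) := by
    intro ℓ
    split_ifs with hℓ
    · exact hμ₂0 ℓ hℓ
    · exact hμ₁0 ℓ (Finset.mem_compl.2 hℓ)
  have hW : (Fin.cons z Z : Fin (k + 1) → Fin n → ℝ) ∈ D := fun ℓ => by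
    rw [Fin.cons_succ]; exact (hr ℓ).trans_lt (EReal.coe_lt_top _)
  have hmain := hζ _ hW
  have hsum : ∑ ℓ ∈ Aᶜ, μ₁ ℓ * h ℓ (Fin.cons z Z) + ∑ ℓ ∈ A, μ₂ ℓ * h ℓ (Fin.cons z Z)
      = ∑ ℓ, (if ℓ ∈ A then μ₂ ℓ else μ₁ ℓ) * h ℓ (Fin.cons z Z) := by
    rw [← Finset.sum_compl_add_sum A]
    congr 1
    · exact Finset.sum_congr rfl fun ℓ hℓ => by rw [if_neg (Finset.mem_compl.1 hℓ)]
    · exact Finset.sum_congr rfl fun ℓ hℓ => by rw [if_pos hℓ]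
  have hle : ∑ ℓ, (if ℓ ∈ A then μ₂ ℓ else μ₁ ℓ) * h ℓ (Fin.cons z Z)
      ≤ ∑ ℓ, (if ℓ ∈ A then μ₂ ℓ else μ₁ ℓ) * r ℓ := by
    refine Finset.sum_le_sum fun ℓ _ => mul_le_mul_of_nonneg_left ?_ (hν0 ℓ)
    have h1 := hcoe _ hW ℓ
    rw [Fin.cons_succ] at h1
    exact EReal.coe_le_coe_iff.1 (h1.le.trans (hr ℓ))
  have heq : ∑ q, ζ q * e q (Fin.cons z Z) = ∑ ℓ, dotp (fun i => ζ (ℓ, i)) (Z ℓ - z) := by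
    rw [Fintype.sum_prod_type]
    simp [he, dotp]
  rw [heq] at hmain
  simp only [hF, Fin.cons_zero] at hmain
  rw [Finset.sum_add_distrib]
  linarith

theorem exists_linear_decomposition (φ : ((Fin k → Fin n → ℝ) × (Fin k → ℝ) × ℝ) →ₗ[ℝ] ℝ) :
    ∃ (a : Fin k → Fin n → ℝ) (σ : Fin k → ℝ) (β : ℝ), ∀ u s r,
      φ (u, s, r) = ∑ ℓ, (dotp (a ℓ) (u ℓ) + σ ℓ * s ℓ) + β * r := by
  have h1 : ∀ ℓ, ∃ a : Fin n → ℝ, ∀ v, φ (Pi.single ℓ v, 0, 0) = dotp a v := fun ℓ =>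
    exists_dotp_eq (φ ∘ₗ LinearMap.inl ℝ _ _ ∘ₗ LinearMap.single ℝ (fun _ => Fin n → ℝ) ℓ)
  choose a ha using h1
  obtain ⟨σ, hσ⟩ := exists_dotp_eq
    (φ ∘ₗ LinearMap.inr ℝ (Fin k → Fin n → ℝ) ((Fin k → ℝ) × ℝ) ∘ₗ LinearMap.inl ℝ (Fin k → ℝ) ℝ)
  refine ⟨a, σ, φ (0, 0, 1), fun u s r => ?_⟩
  have h2 : ((u, s, r) : (Fin k → Fin n → ℝ) × (Fin k → ℝ) × ℝ)
      = LinearMap.inl ℝ _ _ u + (0, s, 0) + r • (0, 0, 1) := by simp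
  have h3 : φ (LinearMap.inl ℝ _ _ u) = ∑ ℓ, dotp (a ℓ) (u ℓ) := by
    conv_lhs => rw [← Finset.univ_sum_single u]
    rw [map_sum, map_sum]
    exact Finset.sum_congr rfl fun ℓ _ => ha ℓ (u ℓ)
  have h4 : φ (0, s, 0) = ∑ ℓ, σ ℓ * s ℓ := hσ s
  rw [h2, map_add, map_add, map_smul, h3, h4, Finset.sum_add_distrib, smul_eq_mul, mul_comm r]

/-- Truncation of `z` to the closed ball of radius `R` around `z₀` along the segment to `z₀`. -/
theorem exists_radial_truncation (z₀ z : Fin n → ℝ) {R : ℝ} (hR : 0 < R) :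
    ∃ (θ : ℝ) (w : Fin n → ℝ), 0 ≤ θ ∧ θ ≤ 1 ∧ w = (1 - θ) • z₀ + θ • z ∧
      ‖w - z₀‖ ≤ R ∧ (‖w - z₀‖ < R → w = z) := by
  by_cases h : ‖z - z₀‖ ≤ R
  · exact ⟨1, z, zero_le_one, le_rfl, by simp, h, fun _ => rfl⟩
  · push Not at h
    have hpos := hR.trans h
    have hnorm : ‖((1 - R / ‖z - z₀‖) • z₀ + (R / ‖z - z₀‖) • z) - z₀‖ = R := by
      have h1 : ((1 - R / ‖z - z₀‖) • z₀ + (R / ‖z - z₀‖) • z) - z₀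
          = (R / ‖z - z₀‖) • (z - z₀) := by module
      rw [h1, norm_smul, Real.norm_of_nonneg (by positivity), div_mul_cancel₀ _ hpos.ne']
    exact ⟨R / ‖z - z₀‖, _, by positivity, (div_le_one hpos).2 h.le, rfl, hnorm.le,
      fun hlt => absurd hnorm hlt.ne⟩

theorem exists_splitCertificate_of_isCompact (hg : ConcaveOn ℝ Set.univ g)
    (hgu : UpperSemicontinuous g) (hC : AssumptionC c) (hZ : (Zset c).Nonempty)
    (hcomp : IsCompact (Zset c)) (hM : ∀ z ∈ Zset c, g z < M) :
    ∃ η ν, IsSplitCertificate g c M η ν := by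
  obtain ⟨z₀, hz₀⟩ := hZ
  set S : Set ((Fin k → Fin n → ℝ) × (Fin k → ℝ) × ℝ) :=
    {q | ∃ z, (∀ ℓ, c ℓ (z + q.1 ℓ) ≤ (q.2.1 ℓ : EReal)) ∧ q.2.2 ≤ g z} with hS
  have hSconv : Convex ℝ S := by
    rintro ⟨u, s, r⟩ ⟨z, hz, hr⟩ ⟨u', s', r'⟩ ⟨z', hz', hr'⟩ a b ha hb hab
    refine ⟨a • z + b • z', fun ℓ => ?_, ?_⟩
    · have h1 := (hC ℓ).2.2.combo_le (hz ℓ) (hz' ℓ) ha hb hab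
      have h2 : a • z + b • z' + (a • u + b • u') ℓ = a • (z + u ℓ) + b • (z' + u' ℓ) := by
        simp only [Pi.add_apply, Pi.smul_apply]; module
      exact (congrArg (c ℓ) h2).trans_le h1
    · have h1 := hg.2 (Set.mem_univ z) (Set.mem_univ z') ha hb hab
      refine le_trans ?_ h1
      exact add_le_add (mul_le_mul_of_nonneg_left hr ha) (mul_le_mul_of_nonneg_left hr' hb)
  have hnot : ((0, 0, M) : (Fin k → Fin n → ℝ) × (Fin k → ℝ) × ℝ) ∉ closure S := by
    intro hcl
    obtain ⟨q, hq, hlim⟩ := mem_closure_iff_seq_limit.1 hcl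
    choose z hz hr using hq
    obtain ⟨R, hR, hball⟩ := hcomp.isBounded.subset_ball_lt 0 z₀
    choose θ w hθ0 hθ1 hw hwR hwz using fun m => exists_radial_truncation z₀ (z m) hR
    obtain ⟨w', -, ψ, hψ, hwlim⟩ := (isCompact_closedBall z₀ R).tendsto_subseq
      (x := w) (fun m => by rw [mem_closedBall_iff_norm]; exact hwR m)
    have hq' := hlim.comp hψ.tendsto_atTop
    have hulim : Filter.Tendsto (fun m => (q (ψ m)).1) Filter.atTop (nhds 0) :=
      (continuous_fst.tendsto _).comp hq'
    have hslim : Filter.Tendsto (fun m => (q (ψ m)).2.1) Filter.atTop (nhds 0) :=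
      ((continuous_fst.comp continuous_snd).tendsto _).comp hq'
    have hrlim : Filter.Tendsto (fun m => (q (ψ m)).2.2) Filter.atTop (nhds M) :=
      ((continuous_snd.comp continuous_snd).tendsto _).comp hq'
    have hw'Z : w' ∈ Zset c := by
      intro ℓ
      have hmem : ∀ m, (w (ψ m) + θ (ψ m) • (q (ψ m)).1 ℓ, max ((q (ψ m)).2.1 ℓ) 0) ∈
          {p : (Fin n → ℝ) × ℝ | c ℓ p.1 ≤ (p.2 : EReal)} := by
        intro m
        have h1 := (hC ℓ).2.2.combo_le (r := 0) (hz₀ ℓ) (hz (ψ m) ℓ)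
          (sub_nonneg.2 (hθ1 (ψ m))) (hθ0 (ψ m)) (sub_add_cancel _ _)
        have h2 : w (ψ m) + θ (ψ m) • (q (ψ m)).1 ℓ
            = (1 - θ (ψ m)) • z₀ + θ (ψ m) • (z (ψ m) + (q (ψ m)).1 ℓ) := by
          rw [hw (ψ m)]; module
        refine (congrArg (c ℓ) h2).trans_le (h1.trans (EReal.coe_le_coe_iff.2 ?_))
        rw [mul_zero, zero_add]
        calc θ (ψ m) * (q (ψ m)).2.1 ℓ ≤ θ (ψ m) * max ((q (ψ m)).2.1 ℓ) 0 :=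
              mul_le_mul_of_nonneg_left (le_max_left _ _) (hθ0 _)
          _ ≤ 1 * max ((q (ψ m)).2.1 ℓ) 0 :=
              mul_le_mul_of_nonneg_right (hθ1 _) (le_max_right _ _)
          _ = _ := one_mul _
      have hul : Filter.Tendsto (fun m => (q (ψ m)).1 ℓ) Filter.atTop (nhds 0) :=
        (tendsto_pi_nhds.1 hulim) ℓ
      have hθu : Filter.Tendsto (fun m => θ (ψ m) • (q (ψ m)).1 ℓ) Filter.atTop (nhds 0) := by
        refine squeeze_zero_norm (fun m => ?_) (tendsto_zero_iff_norm_tendsto_zero.1 hul)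
        rw [norm_smul, Real.norm_of_nonneg (hθ0 _)]
        exact mul_le_of_le_one_left (norm_nonneg _) (hθ1 _)
      have h1 := hwlim.add hθu
      rw [add_zero] at h1
      have h2 : Filter.Tendsto (fun m => max ((q (ψ m)).2.1 ℓ) 0) Filter.atTop (nhds 0) := by
        simpa using ((tendsto_pi_nhds.1 hslim) ℓ).max (tendsto_const_nhds (x := (0 : ℝ)))
      have h3 := (hC ℓ).2.1.isClosed_real_epigraph.mem_of_tendsto (h1.prodMk_nhds h2)
        (Filter.Eventually.of_forall hmem)
      simpa using h3
    have hlt : ‖w' - z₀‖ < R := by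
      rw [← mem_ball_iff_norm]; exact hball hw'Z
    have hev1 : ∀ᶠ m in Filter.atTop, ‖w (ψ m) - z₀‖ < R :=
      ((hwlim.sub_const z₀).norm).eventually_lt_const hlt
    obtain ⟨b, hb1, hb2⟩ := exists_between (hM w' hw'Z)
    have hev2 : ∀ᶠ m in Filter.atTop, g (w (ψ m)) < b := hwlim.eventually (hgu w' b hb1)
    have hev3 : ∀ᶠ m in Filter.atTop, b < (q (ψ m)).2.2 := hrlim.eventually_const_lt hb2
    obtain ⟨m, h1, h2, h3⟩ := (hev1.and (hev2.and hev3)).exists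
    rw [hwz _ h1] at h2
    exact absurd (hr (ψ m)) (by linarith)
  obtain ⟨φ, u₀, hu₀, hφ⟩ := geometric_hahn_banach_point_closed hSconv.closure isClosed_closure hnot
  obtain ⟨a, σ, β, hdec⟩ := exists_linear_decomposition φ.toLinearMap
  have hkey : ∀ u s r, (u, s, r) ∈ S → β * M < ∑ ℓ, (dotp (a ℓ) (u ℓ) + σ ℓ * s ℓ) + β * r := by
    intro u s r hmem
    have h1 := hu₀.trans (hφ _ (subset_closure hmem))
    have h2 : φ (0, 0, M) = β * M := by
      refine (hdec 0 0 M).trans ?_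
      simp [dotp_zero_right]
    have h3 : φ (u, s, r) = _ := hdec u s r
    rwa [h2, h3] at h1
  have hβ : β < 0 := by
    have h1 := hkey 0 0 (g z₀) ⟨z₀, fun ℓ => by simpa using hz₀ ℓ, le_rfl⟩
    simp only [Pi.zero_apply, dotp_zero_right, mul_zero, add_zero, Finset.sum_const_zero,
      zero_add] at h1
    by_contra hcon
    exact absurd h1 (not_lt.2 (mul_le_mul_of_nonneg_left (hM z₀ hz₀).le (not_lt.1 hcon)))
  have hσ : ∀ ℓ, 0 ≤ σ ℓ := by
    intro ℓ
    by_contra hcon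
    push Not at hcon
    have hray : ∀ t : ℝ, 0 ≤ t → β * M < σ ℓ * t + β * g z₀ := by
      intro t ht
      have h1 := hkey 0 (Pi.single ℓ t) (g z₀) ⟨z₀, fun j => by
        have h2 : (0 : ℝ) ≤ (Pi.single ℓ t : Fin k → ℝ) j := by
          by_cases hj : j = ℓ
          · subst hj; simpa using ht
          · simp [hj]
        simpa using (hz₀ j).trans (EReal.coe_nonneg.2 h2), le_rfl⟩
      simpa [dotp_zero_right, Pi.single_apply] using h1
    have h1 := hray ((β * g z₀ - β * M) / (-σ ℓ)) (div_nonneg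
      (by nlinarith [hM z₀ hz₀]) (by linarith))
    have h2 : σ ℓ * ((β * g z₀ - β * M) / (-σ ℓ)) = -(β * g z₀ - β * M) := by
      have := hcon.ne
      field_simp
    linarith
  refine ⟨fun ℓ => (-β)⁻¹ • a ℓ, fun ℓ => (-β)⁻¹ * σ ℓ,
    fun ℓ => mul_nonneg (inv_nonneg.2 (by linarith)) (hσ ℓ), fun z Z r hr => ?_⟩
  have h1 := hkey (fun ℓ => Z ℓ - z) r (g z) ⟨z, fun ℓ => by simpa using hr ℓ, le_rfl⟩
  have h2 : ∑ ℓ, ((-β)⁻¹ * σ ℓ * r ℓ + dotp ((-β)⁻¹ • a ℓ) (Z ℓ - z))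
      = (-β)⁻¹ * ∑ ℓ, (dotp (a ℓ) (Z ℓ - z) + σ ℓ * r ℓ) := by
    rw [Finset.mul_sum]
    refine Finset.sum_congr rfl fun ℓ _ => ?_
    rw [dotp_smul_left]
    ring
  rw [h2]
  have hb : 0 < -β := by linarith
  have h3 : g z - M ≤ (-β)⁻¹ * ∑ ℓ, (dotp (a ℓ) (Z ℓ - z) + σ ℓ * r ℓ) := by
    rw [inv_mul_eq_div, le_div_iff₀ hb]
    linarith
  linarith

end LagrangeDuality

section Reformulation

theorem exists_pwpTerm_le {g : (Fin dx → ℝ) → (Fin dz → ℝ) → ℝ}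
    {c : Fin L → (Fin dz → ℝ) → EReal} {x : Fin dx → ℝ} {M : ℝ} (hC : AssumptionC c)
    (h : ∃ η ν, IsSplitCertificate (g x) c M η ν) :
    ∃ (y : Fin (L + 1) → Fin dz → ℝ) (ν : Fin L → ℝ),
      (∑ ℓ, y ℓ) = 0 ∧ (∀ ℓ, 0 ≤ ν ℓ) ∧ pwpTerm g c x y ν ≤ (M : EReal) := by
  obtain ⟨η, ν, hν, hcert⟩ := h
  let S : Fin (L + 1) → Set ((Fin dz → ℝ) × ℝ) :=
    Fin.cons Set.univ (fun ℓ => {p | c ℓ p.1 ≤ (p.2 : EReal)})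
  let B : Fin (L + 1) → (Fin dz → ℝ) × ℝ → ℝ :=
    Fin.cons (fun p => dotp (∑ ℓ, η ℓ) p.1 + g x p.1)
      (fun ℓ p => dotp (-η ℓ) p.1 - ν ℓ * p.2)
  have hS : ∀ i, (S i).Nonempty := by
    refine Fin.cases Set.univ_nonempty fun ℓ => ?_
    obtain ⟨z, hz⟩ := (hC ℓ).1.2
    exact ⟨(z, _), (coe_toReal_of_mem_edom (hC ℓ).1 (lt_top_iff_ne_top.2 hz)).ge⟩
  have hM : ∀ b : Fin (L + 1) → (Fin dz → ℝ) × ℝ, (∀ i, b i ∈ S i) → ∑ i, B i (b i) ≤ M := by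
    intro b hb
    have h1 := hcert (b 0).1 (fun ℓ => (b ℓ.succ).1) (fun ℓ => (b ℓ.succ).2)
      (fun ℓ => hb ℓ.succ)
    refine le_trans (le_of_eq ?_) h1
    rw [Fin.sum_univ_succ]
    simp only [B, Fin.cons_zero, Fin.cons_succ, dotp_sum_left, dotp_neg_left, dotp_sub_right,
      Finset.sum_add_distrib, Finset.sum_sub_distrib, Finset.sum_neg_distrib]
    ring
  obtain ⟨m, hm, hsum⟩ := exists_separate_bounds hS hM
  refine ⟨Fin.cons (∑ ℓ, η ℓ) (fun ℓ => -η ℓ), ν, ?_, hν, ?_⟩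
  · simp [Fin.sum_univ_succ]
  · have h0 : pconj2neg g x (∑ ℓ, η ℓ) ≤ (m 0 : EReal) :=
      iSup_le fun z => EReal.coe_le_coe_iff.2 (hm 0 (z, 0) (Set.mem_univ _))
    have h1 : ∀ ℓ, persp (conjFn (c ℓ)) (-η ℓ) (ν ℓ) ≤ (m ℓ.succ : EReal) := fun ℓ =>
      persp_conjFn_le (hC ℓ).1 (hC ℓ).2.1 (hC ℓ).2.2 (hν ℓ)
        (fun z r hz => hm ℓ.succ (z, r) hz)
    have h2 := add_le_add h0 (Finset.sum_le_sum fun ℓ (_ : ℓ ∈ Finset.univ) => h1 ℓ)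
    refine h2.trans ?_
    rw [← EReal.coe_finset_sum_real, ← EReal.coe_add, ← Fin.sum_univ_succ]
    exact EReal.coe_le_coe_iff.2 hsum

variable {f : Fin (I + 1) → (Fin dx → ℝ) → (Fin dz → ℝ) → ℝ}
  {c : Fin L → (Fin dz → ℝ) → EReal}

theorem Gsup_le_pwpTerm (hC : AssumptionC c) (i : Fin (I + 1)) (x : Fin dx → ℝ)
    {y : Fin (L + 1) → Fin dz → ℝ} {ν : Fin L → ℝ} (hy : (∑ ℓ, y ℓ) = 0)
    (hν : ∀ ℓ, 0 ≤ ν ℓ) : Gsup f c i x ≤ pwpTerm (f i) c x y ν := by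
  refine iSup₂_le fun z hz => ?_
  have h1 : ((dotp (y 0) z + f i x z : ℝ) : EReal) ≤ pconj2neg (f i) x (y 0) :=
    le_iSup (fun z => ((dotp (y 0) z + f i x z : ℝ) : EReal)) z
  have h2 := add_le_add h1 (Finset.sum_le_sum fun ℓ (_ : ℓ ∈ Finset.univ) =>
    dotp_le_persp_conjFn (hC ℓ).1 (hz ℓ) (y ℓ.succ) (hν ℓ))
  refine le_trans (le_of_eq ?_) h2
  rw [← EReal.coe_finset_sum_real, ← EReal.coe_add]
  congr 1
  have h3 : dotp (∑ ℓ, y ℓ) z = 0 := by rw [hy]; simp [dotp]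
  rw [dotp_sum_left, Fin.sum_univ_succ] at h3
  linarith

theorem fst_mem_pwFeas (hC : AssumptionC c) {p} (hp : p ∈ pwpFeas f c) : p.1 ∈ pwFeas f c :=
  ⟨fun i => (Gsup_le_pwpTerm hC _ _ (hp.2.1 _) (hp.2.2.1 _)).trans (hp.1 i),
    ne_top_of_le_ne_top hp.2.2.2 (Gsup_le_pwpTerm hC _ _ (hp.2.1 _) (hp.2.2.1 _))⟩

theorem pwVal_le_pwpVal (hC : AssumptionC c) : pwVal f c ≤ pwpVal f c :=
  le_iInf₂ fun p hp => iInf₂_le_of_le p.1 (fst_mem_pwFeas hC hp)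
    (Gsup_le_pwpTerm hC _ _ (hp.2.1 _) (hp.2.2.1 _))

theorem exists_mem_pwpFeas (hC : AssumptionC c) {x : Fin dx → ℝ} {M : ℝ}
    (h0 : ∃ η ν, IsSplitCertificate (f 0 x) c M η ν)
    (h : ∀ i : Fin I, ∃ η ν, IsSplitCertificate (f i.succ x) c 0 η ν) :
    ∃ p ∈ pwpFeas f c, p.1 = x ∧ pwpTerm (f 0) c p.1 (p.2.1 0) (p.2.2 0) ≤ (M : EReal) := by
  obtain ⟨y₀, ν₀, hy₀, hν₀, hle₀⟩ := exists_pwpTerm_le hC h0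
  choose y ν hy hν hle using fun i => exists_pwpTerm_le hC (h i)
  refine ⟨(x, Fin.cons y₀ y, Fin.cons ν₀ ν), ⟨fun i => ?_, ?_, ?_, ?_⟩, rfl, by simpa using hle₀⟩
  · simpa using hle i
  · exact Fin.cases (by simpa using hy₀) (fun i => by simpa using hy i)
  · exact Fin.cases (by simpa using hν₀) (fun i => by simpa using hν i)
  · exact ne_top_of_le_ne_top (EReal.coe_ne_top M) (by simpa using hle₀)

theorem exists_coe_eq_Gsup (hZ : (Zset c).Nonempty) {i : Fin (I + 1)} {x : Fin dx → ℝ}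
    (h : Gsup f c i x ≠ ⊤) :
    ∃ m : ℝ, (m : EReal) = Gsup f c i x ∧ ∀ z ∈ Zset c, f i x z ≤ m := by
  obtain ⟨z₀, hz₀⟩ := hZ
  have hle : ∀ z ∈ Zset c, (f i x z : EReal) ≤ Gsup f c i x := fun z hz =>
    le_iSup₂ (f := fun z (_ : z ∈ Zset c) => (f i x z : EReal)) z hz
  have h1 := EReal.coe_toReal h (ne_bot_of_le_ne_bot (EReal.coe_ne_bot _) (hle z₀ hz₀))
  refine ⟨_, h1, fun z hz => EReal.coe_le_coe_iff.1 ?_⟩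
  rw [h1]
  exact hle z hz

theorem le_of_Gsup_le {i : Fin (I + 1)} {x : Fin dx → ℝ} {M : ℝ}
    (h : Gsup f c i x ≤ (M : EReal)) {z : Fin dz → ℝ} (hz : z ∈ Zset c) : f i x z ≤ M :=
  EReal.coe_le_coe_iff.1
    ((le_iSup₂ (f := fun z (_ : z ∈ Zset c) => (f i x z : EReal)) z hz).trans h)

theorem lt_of_Gsup_lt {i : Fin (I + 1)} {x : Fin dx → ℝ} {M : ℝ}
    (h : Gsup f c i x < (M : EReal)) {z : Fin dz → ℝ} (hz : z ∈ Zset c) : f i x z < M :=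
  EReal.coe_lt_coe_iff.1
    ((le_iSup₂ (f := fun z (_ : z ∈ Zset c) => (f i x z : EReal)) z hz).trans_lt h)

theorem exists_mem_pwpFeas_of_slater (hRF : AssumptionRF f) (hC : AssumptionC c)
    (hZ : (Zset c).Nonempty) {zS : Fin dz → ℝ} (hS : SlaterZ c zS) {x : Fin dx → ℝ}
    (hx : x ∈ pwFeas f c) :
    ∃ p ∈ pwpFeas f c, p.1 = x ∧
      pwpTerm (f 0) c p.1 (p.2.1 0) (p.2.2 0) ≤ Gsup f c 0 x := by
  obtain ⟨m, hm, hle⟩ := exists_coe_eq_Gsup hZ hx.2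
  rw [← hm]
  exact exists_mem_pwpFeas hC
    (exists_splitCertificate_of_slater ((hRF 0).2 x).1 hC hS hle)
    (fun i => exists_splitCertificate_of_slater ((hRF i.succ).2 x).1 hC hS
      fun z hz => le_of_Gsup_le (hx.1 i) hz)

theorem pwpVal_le_Gsup_of_strictSlater (hRF : AssumptionRF f) (hC : AssumptionC c)
    (hZ : (Zset c).Nonempty) (hcomp : IsCompact (Zset c)) {xS : Fin dx → ℝ}
    (hS : StrictSlaterPW f c xS) {x : Fin dx → ℝ} (hx : x ∈ pwFeas f c) :
    pwpVal f c ≤ Gsup f c 0 x := by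
  obtain ⟨m, hm, hle⟩ := exists_coe_eq_Gsup hZ hx.2
  obtain ⟨mS, -, hleS⟩ := exists_coe_eq_Gsup hZ (intrinsicInterior_subset (hS.1 0)).ne
  have hθ : ∀ θ ∈ Set.Ioc (0 : ℝ) 1,
      pwpVal f c ≤ (((1 - θ) * m + θ * mS + θ : ℝ) : EReal) := by
    rintro θ ⟨h0, h1⟩
    have hconv : ∀ i z, f i ((1 - θ) • x + θ • xS) z ≤ (1 - θ) * f i x z + θ * f i xS z :=
      fun i z => ((hRF i).1 z).1.2 (Set.mem_univ x) (Set.mem_univ xS) (sub_nonneg.2 h1) h0.le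
        (sub_add_cancel _ _)
    obtain ⟨p, hp, -, hple⟩ := exists_mem_pwpFeas (f := f) (M := (1 - θ) * m + θ * mS + θ) hC
      (exists_splitCertificate_of_isCompact ((hRF 0).2 ((1 - θ) • x + θ • xS)).1
        ((hRF 0).2 _).2 hC hZ hcomp fun z hz => by
          have h2 := mul_le_mul_of_nonneg_left (hle z hz) (sub_nonneg.2 h1)
          have h3 := mul_le_mul_of_nonneg_left (hleS z hz) h0.le
          linarith [hconv 0 z])
      (fun i => exists_splitCertificate_of_isCompact ((hRF i.succ).2 ((1 - θ) • x + θ • xS)).1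
        ((hRF i.succ).2 _).2 hC hZ hcomp fun z hz => by
          have h2 := mul_nonpos_of_nonneg_of_nonpos (sub_nonneg.2 h1)
            (le_of_Gsup_le (hx.1 i) hz)
          have h3 := mul_neg_of_pos_of_neg h0 (lt_of_Gsup_lt (hS.2 i) hz)
          linarith [hconv i.succ z])
    exact iInf₂_le_of_le p hp hple
  rw [← hm]
  have hcont : Filter.Tendsto (fun θ : ℝ => (((1 - θ) * m + θ * mS + θ : ℝ) : EReal))
      (nhdsWithin 0 (Set.Ioi 0)) (nhds (m : EReal)) := by
    have h1 : Continuous fun θ : ℝ => (((1 - θ) * m + θ * mS + θ : ℝ) : EReal) :=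
      continuous_coe_real_ereal.comp (by fun_prop)
    simpa using (h1.tendsto 0).mono_left nhdsWithin_le_nhds
  exact ge_of_tendsto hcont
    (Filter.mem_of_superset (Ioc_mem_nhdsGT zero_lt_one) hθ)

theorem pwSolvable_of_pwpSolvable (hC : AssumptionC c) (hval : pwVal f c = pwpVal f c)
    (h : pwpSolvable f c) : pwSolvable f c := by
  rcases h with h | ⟨p, hp, hpv⟩
  · left
    have htop : pwVal f c = ⊤ := by simp [hval, pwpVal, h]
    refine Set.eq_empty_of_forall_notMem fun x hx => hx.2 (top_le_iff.1 ?_)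
    rw [← htop]
    exact iInf₂_le x hx
  · refine .inr ⟨p.1, fst_mem_pwFeas hC hp, le_antisymm ?_ (iInf₂_le p.1 (fst_mem_pwFeas hC hp))⟩
    rw [hval, ← hpv]
    exact Gsup_le_pwpTerm hC _ _ (hp.2.1 _) (hp.2.2.1 _)

end Reformulation

/-- **Convex reformulation of the primal worst problem** (Proposition 3.1):
under assumptions (RF) and (C) and nonemptiness of `Z`,
(i) `inf (P-W) ≤ inf (P-W')`;
(ii) if `Z` admits a Slater point, then `inf (P-W) = inf (P-W')` and (P-W) is solvable
iff (P-W') is solvable;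
(iii) if `Z` is compact and (P-W) admits a strict Slater point, then
`inf (P-W) = inf (P-W')` and (P-W) is solvable whenever (P-W') is solvable. -/
theorem primal_worst_convex_reformulation (dx dz I L : ℕ)
    (f : Fin (I + 1) → (Fin dx → ℝ) → (Fin dz → ℝ) → ℝ)
    (c : Fin L → (Fin dz → ℝ) → EReal)
    (hRF : AssumptionRF f) (hC : AssumptionC c) (hZ : (Zset c).Nonempty) :
    (pwVal f c ≤ pwpVal f c) ∧
    ((∃ zS, SlaterZ c zS) →
      pwVal f c = pwpVal f c ∧ (pwSolvable f c ↔ pwpSolvable f c)) ∧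
    (IsCompact (Zset c) → (∃ xS, StrictSlaterPW f c xS) →
      pwVal f c = pwpVal f c ∧ (pwpSolvable f c → pwSolvable f c)) := by
  have hweak := pwVal_le_pwpVal (f := f) hC
  refine ⟨hweak, ?_, ?_⟩
  · rintro ⟨zS, hS⟩
    have hval : pwVal f c = pwpVal f c := hweak.antisymm <| le_iInf₂ fun x hx => by
      obtain ⟨p, hp, -, hle⟩ := exists_mem_pwpFeas_of_slater hRF hC hZ hS hx
      exact iInf₂_le_of_le p hp hle
    refine ⟨hval, ?_, pwSolvable_of_pwpSolvable hC hval⟩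
    rintro (h | ⟨x, hx, hxv⟩)
    · refine .inl (Set.eq_empty_of_forall_notMem fun p hp => ?_)
      exact Set.notMem_empty p.1 (h ▸ fst_mem_pwFeas hC hp)
    · obtain ⟨p, hp, -, hle⟩ := exists_mem_pwpFeas_of_slater hRF hC hZ hS hx
      exact .inr ⟨p, hp, (hle.trans (hxv.trans hval).le).antisymm (iInf₂_le p hp)⟩
  · rintro hcomp ⟨xS, hS⟩
    have hval : pwVal f c = pwpVal f c := hweak.antisymm <| le_iInf₂ fun x hx =>
      pwpVal_le_Gsup_of_strictSlater hRF hC hZ hcomp hS hx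
    exact ⟨hval, pwSolvable_of_pwpSolvable hC hval⟩
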